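/- Within one point p, the funnel contribution is monotone under restriction to a left range: let P be a finite point set with distinct x- and y-coordinates, partitioned into P_L and P_R where all x-coordinates in P_L are smaller than those in P_R. Then for every p ∈ P_L, F_L(P_L,p) = F_L(P,p) and F_R(P_L,p) ⊆ F_R(P,p), and consequently f(P,p) ≥ f(P_L,p). -/

import Mathlib

/-- Number of maximal blocks of equal symbols in a string over `{L,R}` (as `Bool`s). -/
def blocks : List Bool → ℕ
  | [] => 0
  | [_] => 1
  | a :: b :: l => (if a = b then 0 else 1) + blocks (b :: l)

/-- The labeled merge of two finite sets of reals: sort `L ∪ R` increasingly and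
label each element by whether it came from `L` (`true`) or not. -/
noncomputable def mix (L R : Finset ℝ) : List Bool :=
  ((L ∪ R).sort (· ≤ ·)).map (fun x => decide (x ∈ L))

/-- `mixValue L R` is the number of maximal same-origin blocks in the merged sorted sequence. -/
noncomputable def mixValue (L R : Finset ℝ) : ℕ := blocks (mix L R)
/-- Membership in the minimal axis-aligned rectangle spanned by `p` and `q`. -/
def inRect (p q t : ℝ × ℝ) : Prop :=
  min p.1 q.1 ≤ t.1 ∧ t.1 ≤ max p.1 q.1 ∧ min p.2 q.2 ≤ t.2 ∧ t.2 ≤ max p.2 q.2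

noncomputable instance (p q t : ℝ × ℝ) : Decidable (inRect p q t) := by
  unfold inRect; infer_instance

/-- The left funnel of `p` within `P`. -/
noncomputable def FL (P : Finset (ℝ × ℝ)) (p : ℝ × ℝ) : Finset (ℝ × ℝ) :=
  P.filter (fun q => q.2 < p.2 ∧ q.1 < p.1 ∧ ∀ t ∈ P, inRect p q t → t = p ∨ t = q)

/-- The right funnel of `p` within `P`. -/
noncomputable def FR (P : Finset (ℝ × ℝ)) (p : ℝ × ℝ) : Finset (ℝ × ℝ) :=
  P.filter (fun q => q.2 < p.2 ∧ q.1 > p.1 ∧ ∀ t ∈ P, inRect p q t → t = p ∨ t = q)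

/-- The funnel contribution `f(P,p)`. -/
noncomputable def fContrib (P : Finset (ℝ × ℝ)) (p : ℝ × ℝ) : ℕ :=
  mixValue ((FL P p).image Prod.snd) ((FR P p).image Prod.snd)

/-- Wilber's Funnel bound. -/
noncomputable def Funnel (P : Finset (ℝ × ℝ)) : ℕ := ∑ p ∈ P, fContrib P p

/-- All points of `P` have distinct `y`-coordinates. -/
def DistinctY (P : Finset (ℝ × ℝ)) : Prop :=
  ∀ p ∈ P, ∀ q ∈ P, p.2 = q.2 → p = q

/-- All points of `P` have distinct `x`-coordinates. -/
def DistinctX (P : Finset (ℝ × ℝ)) : Prop :=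
  ∀ p ∈ P, ∀ q ∈ P, p.1 = q.1 → p = q

lemma blocks_le_cons (a : Bool) (l : List Bool) : blocks l ≤ blocks (a :: l) := by
  cases l with
  | nil => simp [blocks]
  | cons b l => simp [blocks]

lemma blocks_insert (a b : Bool) (l : List Bool) :
    blocks (a :: l) ≤ (if a = b then 0 else 1) + blocks (b :: l) := by
  cases l with
  | nil => simp [blocks]
  | cons c l => cases a <;> cases b <;> cases c <;> simp [blocks] <;> omega

lemma blocks_cons_sublist {l₁ l₂ : List Bool} (h : l₁.Sublist l₂) :
    ∀ a, blocks (a :: l₁) ≤ blocks (a :: l₂) := by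
  induction h with
  | slnil => intro a; exact le_rfl
  | cons b h ih =>
    intro a
    have h1 := blocks_insert a b
    exact (h1 _).trans (Nat.add_le_add_left (ih b) _)
  | cons_cons b h ih =>
    intro a
    exact Nat.add_le_add_left (ih b) _

lemma blocks_sublist {l₁ l₂ : List Bool} (h : l₁.Sublist l₂) : blocks l₁ ≤ blocks l₂ := by
  induction h with
  | slnil => exact le_rfl
  | cons b h ih => exact ih.trans (blocks_le_cons _ _)
  | cons_cons b h ih => exact blocks_cons_sublist h b

lemma sort_sublist {A B : Finset ℝ} (h : A ⊆ B) :
    (A.sort (· ≤ ·)).Sublist (B.sort (· ≤ ·)) := by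
  apply List.sublist_of_subperm_of_pairwise (r := (· ≤ ·))
  · apply List.Nodup.subperm (Finset.sort_nodup _ _)
    intro x hx
    simpa using h (by simpa using hx)
  · exact Finset.pairwise_sort _ _
  · exact Finset.pairwise_sort _ _

lemma mixValue_mono_right (L : Finset ℝ) {R R' : Finset ℝ} (h : R ⊆ R') :
    mixValue L R ≤ mixValue L R' :=
  blocks_sublist ((sort_sublist (Finset.union_subset_union_right h)).map _)

theorem funnel_contrib_mono_left_range (P PL PR : Finset (ℝ × ℝ))
    (hunion : P = PL ∪ PR) (hdisj : Disjoint PL PR)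
    (hx : ∀ pl ∈ PL, ∀ pr ∈ PR, pl.1 < pr.1)
    (hX : DistinctX P) (hY : DistinctY P) :
    ∀ p ∈ PL, FL PL p = FL P p ∧ FR PL p ⊆ FR P p ∧ fContrib P p ≥ fContrib PL p := by
  intro p hp
  have key : ∀ q ∈ PL, ∀ t ∈ PR, ¬ inRect p q t := by
    intro q hq t ht hr
    exact absurd hr.2.1 (not_le.mpr (max_lt (hx p hp t ht) (hx q hq t ht)))
  have ext : ∀ q ∈ PL, (∀ t ∈ PL, inRect p q t → t = p ∨ t = q) →
      ∀ t ∈ P, inRect p q t → t = p ∨ t = q := by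
    intro q hq h t ht hr
    rw [hunion, Finset.mem_union] at ht
    rcases ht with ht | ht
    · exact h t ht hr
    · exact absurd hr (key q hq t ht)
  have hsub : PL ⊆ P := by rw [hunion]; exact Finset.subset_union_left
  have h1 : FL PL p = FL P p := by
    apply Finset.Subset.antisymm
    · intro q hq
      simp only [FL, Finset.mem_filter] at hq ⊢
      exact ⟨hsub hq.1, hq.2.1, hq.2.2.1, ext q hq.1 hq.2.2.2⟩
    · intro q hq
      simp only [FL, Finset.mem_filter] at hq ⊢
      obtain ⟨hqP, hy, hlt, hr⟩ := hq
      refine ⟨?_, hy, hlt, fun t ht => hr t (hsub ht)⟩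
      rw [hunion, Finset.mem_union] at hqP
      exact hqP.resolve_right fun h => lt_asymm hlt (hx p hp q h)
  have h2 : FR PL p ⊆ FR P p := by
    intro q hq
    simp only [FR, Finset.mem_filter] at hq ⊢
    exact ⟨hsub hq.1, hq.2.1, hq.2.2.1, ext q hq.1 hq.2.2.2⟩
  refine ⟨h1, h2, ?_⟩
  unfold fContrib
  rw [h1]
  exact mixValue_mono_right _ (Finset.image_subset_image h2)
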